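/- Let U ⊂ ℝ² be open, P = (φ̄,ψ̄) ∈ U, and let q ∈ C²(U) with q(P) = c_* and ∂q/∂ψ(P) > 0. Define β(φ,ψ) = (−A'(q(φ,ψ))/B'(q(φ,ψ)))^{1/2} at all points of U where q ≥ c_*. Then there exists ε > 0 such that: (existence) there exist continuous functions Φ₊, Φ₋ : [ψ̄, ψ̄+ε] → ℝ with Φ₊(ψ̄) = Φ₋(ψ̄) = φ̄, q(Φ₊(ψ),ψ) > c_* and q(Φ₋(ψ),ψ) > c_* for every ψ ∈ (ψ̄, ψ̄+ε], Φ₊ and Φ₋ differentiable on (ψ̄, ψ̄+ε] with Φ₊'(ψ) = β(Φ₊(ψ),ψ) and Φ₋'(ψ) = −β(Φ₋(ψ),ψ); (uniqueness) any two functions with these properties for the same sign coincide on a common right-neighborhood of ψ̄. In particular, there exist exactly one positive and one negative characteristic issuing from the nonexceptional sonic point P, and they contain no sonic point other than P. -/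

import Mathlib

open Real Set MeasureTheory Filter

noncomputable section

/-- The density function `ρ(t) = (1 − ((γ−1)/2) t)^{1/(γ−1)}`. -/
def rhoF (γ t : ℝ) : ℝ := (1 - (γ - 1) / 2 * t) ^ ((1 : ℝ) / (γ - 1))

/-- The critical (sonic) speed `c_* = (2/(γ+1))^{1/2}`. -/
def cstar (γ : ℝ) : ℝ := Real.sqrt (2 / (γ + 1))

/-- The maximal speed `q_max = (2/(γ−1))^{1/2}`. -/
def qmaxF (γ : ℝ) : ℝ := Real.sqrt (2 / (γ - 1))

/-- `A(q) = ∫_{c_*}^q (ρ(s²)+2s²ρ'(s²))/(s ρ(s²)²) ds`. -/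
def Afun (γ q : ℝ) : ℝ :=
  ∫ s in (cstar γ)..q,
    (rhoF γ (s ^ 2) + 2 * s ^ 2 * deriv (rhoF γ) (s ^ 2)) / (s * (rhoF γ (s ^ 2)) ^ 2)

/-- `B(q) = ∫_{c_*}^q ρ(s²)/s ds`. -/
def Bfun (γ q : ℝ) : ℝ := ∫ s in (cstar γ)..q, rhoF γ (s ^ 2) / s

/-- Inverse of `A` restricted to `[c_*, q_max)`. -/
def AplusInv (γ : ℝ) : ℝ → ℝ := Function.invFunOn (Afun γ) (Ico (cstar γ) (qmaxF γ))

/-- `K(s) = B(A₊⁻¹(s))`. -/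
def Kfun (γ s : ℝ) : ℝ := Bfun γ (AplusInv γ s)

/-- `b(s) = −K'(s)`. -/
def bfun (γ s : ℝ) : ℝ := -deriv (Kfun γ) s

/-- `p(s) = −K''(s)`. -/
def pfun (γ s : ℝ) : ℝ := -deriv (deriv (Kfun γ)) s

/-- Partial derivative in the first (potential) variable. -/
def pdx (u : ℝ × ℝ → ℝ) (p : ℝ × ℝ) : ℝ := deriv (fun x => u (x, p.2)) p.1

/-- Partial derivative in the second (stream) variable. -/
def pdy (u : ℝ × ℝ → ℝ) (p : ℝ × ℝ) : ℝ := deriv (fun y => u (p.1, y)) p.2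

/-- The Chaplygin equation (⋆) at a point. -/
def chap (γ : ℝ) (q : ℝ × ℝ → ℝ) (p : ℝ × ℝ) : Prop :=
  pdx (pdx fun z => Afun γ (q z)) p + pdy (pdy fun z => Bfun γ (q z)) p = 0

/-- A (positive for `sgn = 1`, negative for `sgn = -1`) characteristic issuing
from the sonic point `P`, defined on `[P.2, P.2 + ε]`, staying in `U` and in the
supersonic region except at its starting point. -/
def IsChar (γ : ℝ) (U : Set (ℝ × ℝ)) (q : ℝ × ℝ → ℝ) (P : ℝ × ℝ)
    (sgn ε : ℝ) (Φ : ℝ → ℝ) : Prop :=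
  ContinuousOn Φ (Icc P.2 (P.2 + ε)) ∧ Φ P.2 = P.1 ∧
  (∀ ψ ∈ Ioc P.2 (P.2 + ε), (Φ ψ, ψ) ∈ U ∧ cstar γ < q (Φ ψ, ψ)) ∧
  (∀ ψ ∈ Ioc P.2 (P.2 + ε), HasDerivWithinAt Φ
    (sgn * Real.sqrt (-(deriv (Afun γ) (q (Φ ψ, ψ))) / deriv (Bfun γ) (q (Φ ψ, ψ))))
    (Icc P.2 (P.2 + ε)) ψ)

open Topology in
theorem core_exist (G : ℝ × ℝ → ℝ) (P : ℝ × ℝ) (σ : ℝ) (hG : ContDiffAt ℝ 2 G P)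
    (h0 : G P = 0) (ha : 0 < fderiv ℝ G P (0, 1)) (N : Set (ℝ × ℝ)) (hN : N ∈ 𝓝 P) :
    ∃ ε > 0, ∃ Φ : ℝ → ℝ, ContinuousOn Φ (Icc P.2 (P.2 + ε)) ∧ Φ P.2 = P.1 ∧
      ∀ ψ ∈ Ioc P.2 (P.2 + ε), (Φ ψ, ψ) ∈ N ∧ 0 < G (Φ ψ, ψ) ∧
        HasDerivAt Φ (σ * Real.sqrt (G (Φ ψ, ψ))) ψ := by
  set F : (ℝ × ℝ) × ℝ → (ℝ × ℝ) × ℝ := fun z =>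
    ((2 * σ * z.2 ^ 2, 2 * z.2),
      fderiv ℝ G z.1 (0, 1) + σ * fderiv ℝ G z.1 (1, 0) * z.2) with hF
  have hfd : ContDiffAt ℝ 1 (fderiv ℝ G) P := hG.fderiv_right (by norm_num)
  have hfd1 : ContDiffAt ℝ 1 (fun z : (ℝ × ℝ) × ℝ => fderiv ℝ G z.1) (P, 0) :=
    ContDiffAt.comp (P, (0 : ℝ)) hfd contDiffAt_fst
  have hFd : ContDiffAt ℝ 1 F (P, 0) := by
    refine ContDiffAt.prodMk (ContDiffAt.prodMk ?_ ?_) ?_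
    · fun_prop
    · fun_prop
    · exact (hfd1.clm_apply contDiffAt_const).add
        ((contDiffAt_const.mul (hfd1.clm_apply contDiffAt_const)).mul contDiffAt_snd)
  obtain ⟨α, hα0, d0, hd0, hα⟩ :=
    hFd.exists_forall_mem_closedBall_exists_eq_forall_mem_Ioo_hasDerivAt₀ 0
  have hαc : ContinuousAt α 0 := (hα 0 (by constructor <;> linarith)).continuousAt
  have hgood : ∀ᶠ z in 𝓝 ((P, 0) : (ℝ × ℝ) × ℝ),
      z.1 ∈ N ∧ DifferentiableAt ℝ G z.1 ∧ 0 < (F z).2 := by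
    have e1 : ∀ᶠ p in 𝓝 P, p ∈ N ∧ DifferentiableAt ℝ G p := by
      have := hG.eventually (by simp)
      filter_upwards [hN, this] with p hp hp2
      exact ⟨hp, hp2.differentiableAt (by simp)⟩
    have e2 : ∀ᶠ z in 𝓝 ((P, 0) : (ℝ × ℝ) × ℝ), 0 < (F z).2 := by
      apply (hFd.continuousAt.snd).eventually_const_lt
      simpa [hF] using ha
    have e3 : ∀ᶠ z in 𝓝 ((P, 0) : (ℝ × ℝ) × ℝ), z.1 ∈ N ∧ DifferentiableAt ℝ G z.1 :=
      (continuousAt_fst (p := ((P, 0) : (ℝ × ℝ) × ℝ))).eventually e1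
    filter_upwards [e2, e3] with z h1 h2
    exact ⟨h2.1, h2.2, h1⟩
  rw [← hα0] at hgood
  have hev := hαc.eventually hgood
  obtain ⟨d1, hd1, hball⟩ := Metric.eventually_nhds_iff.1 hev
  obtain ⟨δ, hδ, hδ0, hδ1⟩ : ∃ δ > 0, δ < d0 ∧ δ < d1 :=
    ⟨min d0 d1 / 2, by positivity, by linarith [min_le_left d0 d1],
      by linarith [min_le_right d0 d1]⟩
  have hA : ∀ s ∈ Icc 0 δ, HasDerivAt α (F (α s)) s := fun s hs =>
    hα s ⟨by linarith [hs.1], by linarith [hs.2]⟩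
  have hB : ∀ s ∈ Icc 0 δ, (α s).1 ∈ N ∧ DifferentiableAt ℝ G (α s).1 ∧ 0 < (F (α s)).2 := by
    intro s hs
    apply hball
    rw [Real.dist_eq, sub_zero, abs_of_nonneg hs.1]
    linarith [hs.2]
  have hx : ∀ s ∈ Icc 0 δ, HasDerivAt (fun s => (α s).1.1) (2 * σ * (α s).2 ^ 2) s :=
    fun s hs => (hA s hs).fst.fst
  have ht : ∀ s ∈ Icc 0 δ, HasDerivAt (fun s => (α s).1.2) (2 * (α s).2) s :=
    fun s hs => (hA s hs).fst.snd
  have hv : ∀ s ∈ Icc 0 δ, HasDerivAt (fun s => (α s).2) ((F (α s)).2) s :=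
    fun s hs => (hA s hs).snd
  have hvm : StrictMonoOn (fun s => (α s).2) (Icc 0 δ) := by
    apply strictMonoOn_of_deriv_pos (convex_Icc _ _)
    · exact fun s hs => (hv s hs).continuousAt.continuousWithinAt
    · intro s hs
      have hs' := interior_subset hs
      rw [(hv s hs').deriv]
      exact (hB s hs').2.2
  have h0m : (0 : ℝ) ∈ Icc 0 δ := ⟨le_rfl, hδ.le⟩
  have hδm : δ ∈ Icc 0 δ := ⟨hδ.le, le_rfl⟩
  have hvpos : ∀ s ∈ Ioc 0 δ, 0 < (α s).2 := by
    intro s hs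
    have := hvm h0m ⟨hs.1.le, hs.2⟩ hs.1
    simpa [hα0] using this
  have htc : ContinuousOn (fun s => (α s).1.2) (Icc 0 δ) :=
    fun s hs => (ht s hs).continuousAt.continuousWithinAt
  have htm : StrictMonoOn (fun s => (α s).1.2) (Icc 0 δ) := by
    apply strictMonoOn_of_deriv_pos (convex_Icc _ _) htc
    intro s hs
    rw [interior_Icc] at hs
    rw [(ht s ⟨hs.1.le, hs.2.le⟩).deriv]
    have := hvpos s ⟨hs.1, hs.2.le⟩
    positivity
  have hGv : ∀ s ∈ Icc 0 δ, G (α s).1 = (α s).2 ^ 2 := by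
    have hd : ∀ s ∈ Icc 0 δ, HasDerivAt (fun s => G (α s).1 - (α s).2 ^ 2) 0 s := by
      intro s hs
      have h1 := (hB s hs).2.1.hasFDerivAt.comp_hasDerivAt s (hA s hs).fst
      have h2 := h1.sub ((hv s hs).pow 2)
      refine h2.congr_deriv ?_
      have hdec : (F (α s)).1 = (2 * σ * (α s).2 ^ 2) • ((1 : ℝ), (0 : ℝ))
          + (2 * (α s).2) • ((0 : ℝ), (1 : ℝ)) := by
        simp [hF]
      rw [hdec, map_add, map_smul, map_smul]
      simp only [hF, smul_eq_mul]
      push_cast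
      ring
    intro s hs
    have := constant_of_has_deriv_right_zero (a := 0) (b := δ)
      (f := fun s => G (α s).1 - (α s).2 ^ 2)
      (fun s hs => (hd s hs).continuousAt.continuousWithinAt)
      (fun s hs => (hd s ⟨hs.1, hs.2.le⟩).hasDerivWithinAt) s hs
    simp only [hα0, h0] at this
    linarith
  -- extended time function
  set c : ℝ → ℝ := fun s => max 0 (min s δ) with hc
  have hcm : ∀ s, c s ∈ Icc 0 δ := fun s =>
    ⟨le_max_left _ _, max_le hδ.le (min_le_right _ _)⟩
  have hcid : ∀ s ∈ Icc 0 δ, c s = s := fun s hs => by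
    simp [hc, min_eq_left hs.2, max_eq_right hs.1]
  have hcmono : Monotone c := fun s s' h => by
    simp only [hc]; gcongr
  have hccont : Continuous c := by fun_prop
  have hclip : ∀ s s', s ≤ s' → c s' - c s ≤ s' - s := by
    intro s s' h
    simp only [hc]
    rcases le_total s δ with h1 | h1 <;> rcases le_total s' δ with h2 | h2 <;>
    rcases le_total 0 s with h3 | h3 <;> rcases le_total 0 s' with h4 | h4 <;>
    simp [h1, h2, h3, h4, hδ.le] <;> linarith
  set T : ℝ → ℝ := fun s => (α (c s)).1.2 + (s - c s) with hT
  have hTm : StrictMono T := by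
    intro s s' h
    simp only [hT]
    have h1 := hclip s s' h.le
    rcases (hcmono h.le).lt_or_eq with h2 | h2
    · have := htm (hcm s) (hcm s') h2
      simp only at this
      linarith
    · rw [h2]; linarith
  have hTc : Continuous T :=
    (htc.comp_continuous hccont hcm).add (continuous_id.sub hccont)
  have hTs : Function.Surjective T := by
    apply hTc.surjective
    · refine tendsto_atTop_mono (f := fun s => s + ((α 0).1.2 - δ)) (fun s => ?_)
        (tendsto_atTop_add_const_right _ _ tendsto_id)
      have := htm.monotoneOn h0m (hcm s) (hcm s).1
      simp only [hT] at this ⊢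
      linarith [(hcm s).2]
    · refine tendsto_atBot_mono (f := fun s => s + ((α δ).1.2)) (fun s => ?_)
        (tendsto_atBot_add_const_right _ _ tendsto_id)
      have := htm.monotoneOn (hcm s) hδm (hcm s).2
      simp only [hT] at this ⊢
      linarith [(hcm s).1]
  set e := hTm.orderIsoOfSurjective T hTs with he
  have heT : ∀ ψ, T (e.symm ψ) = ψ := fun ψ => e.apply_symm_apply ψ
  have hec : Continuous e.symm := e.symm.continuous
  have hT0 : T 0 = P.2 := by simp [hT, hcid 0 h0m, hα0]
  have hTid : ∀ s ∈ Icc 0 δ, T s = (α s).1.2 := fun s hs => by simp [hT, hcid s hs]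
  have hTδ : P.2 < T δ := by rw [← hT0]; exact hTm hδ
  have hsm : ∀ ψ ∈ Ico P.2 (T δ), e.symm ψ ∈ Ico 0 δ := by
    intro ψ hψ
    constructor
    · rw [← hTm.le_iff_le, heT, hT0]; exact hψ.1
    · rw [← hTm.lt_iff_lt, heT]; exact hψ.2
  have hsm' : ∀ ψ ∈ Ioo P.2 (T δ), e.symm ψ ∈ Ioo 0 δ := by
    intro ψ hψ
    constructor
    · rw [← hTm.lt_iff_lt, heT, hT0]; exact hψ.1
    · rw [← hTm.lt_iff_lt, heT]; exact hψ.2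
  have he0 : e.symm P.2 = 0 := by
    apply hTm.injective; rw [heT, hT0]
  refine ⟨(T δ - P.2) / 2, by linarith, fun ψ => (α (e.symm ψ)).1.1, ?_, ?_, ?_⟩
  · intro ψ hψ
    have hs := hsm ψ ⟨hψ.1, by linarith [hψ.2]⟩
    apply ContinuousAt.continuousWithinAt
    exact ContinuousAt.comp (f := e.symm) (g := fun s => (α s).1.1)
      (hx _ ⟨hs.1, hs.2.le⟩).continuousAt hec.continuousAt
  · simp [he0, hα0]
  · intro ψ hψ
    have hs := hsm' ψ ⟨hψ.1, by linarith [hψ.2]⟩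
    have hsI : e.symm ψ ∈ Icc 0 δ := ⟨hs.1.le, hs.2.le⟩
    have hvp := hvpos _ ⟨hs.1, hs.2.le⟩
    have hpair : ((α (e.symm ψ)).1.1, ψ) = (α (e.symm ψ)).1 := by
      apply Prod.ext
      · rfl
      · simp only; rw [← hTid _ hsI, heT]
    simp only [hpair]
    refine ⟨(hB _ hsI).1, by rw [hGv _ hsI]; positivity, ?_⟩
    rw [hGv _ hsI, Real.sqrt_sq hvp.le]
    have hTd : HasDerivAt T (2 * (α (e.symm ψ)).2) (e.symm ψ) := by
      apply (ht _ hsI).congr_of_eventuallyEq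
      filter_upwards [Ioo_mem_nhds hs.1 hs.2] with s hs
      exact hTid s ⟨hs.1.le, hs.2.le⟩
    have hed := HasDerivAt.of_local_left_inverse hec.continuousAt hTd (by positivity)
      (Eventually.of_forall heT)
    have := HasDerivAt.comp ψ (hx _ hsI) hed
    refine this.congr_deriv ?_
    field_simp

open Topology in
theorem core_lower (G : ℝ × ℝ → ℝ) (P : ℝ × ℝ) (σ : ℝ) (hG : ContDiffAt ℝ 2 G P)
    (h0 : G P = 0) (ha : 0 < fderiv ℝ G P (0, 1)) (ε : ℝ) (hε : 0 < ε) (Φ : ℝ → ℝ)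
    (hc : ContinuousOn Φ (Icc P.2 (P.2 + ε))) (hP : Φ P.2 = P.1)
    (hd : ∀ ψ ∈ Ioo P.2 (P.2 + ε), HasDerivAt Φ (σ * Real.sqrt (G (Φ ψ, ψ))) ψ)
    (N : Set (ℝ × ℝ)) (hN : N ∈ 𝓝 P) :
    ∃ η > 0, η ≤ ε ∧ ∀ ψ ∈ Icc P.2 (P.2 + η), (Φ ψ, ψ) ∈ N ∧
      fderiv ℝ G P (0, 1) / 2 * (ψ - P.2) ≤ G (Φ ψ, ψ) := by
  set a := fderiv ℝ G P (0, 1) with hadef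
  have hfd : ContinuousAt (fderiv ℝ G) P :=
    (hG.fderiv_right (m := 1) (by norm_num)).continuousAt
  have hH : ContinuousAt (fun p => fderiv ℝ G p (0, 1)
      + fderiv ℝ G p (1, 0) * (σ * Real.sqrt (G p))) P :=
    (hfd.clm_apply continuousAt_const).add ((hfd.clm_apply continuousAt_const).mul
      (continuousAt_const.mul hG.continuousAt.sqrt))
  have hgood : ∀ᶠ p in 𝓝 P, p ∈ N ∧ DifferentiableAt ℝ G p ∧
      a / 2 < fderiv ℝ G p (0, 1) + fderiv ℝ G p (1, 0) * (σ * Real.sqrt (G p)) := by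
    have e1 := hG.eventually (by simp)
    have e2 : ∀ᶠ p in 𝓝 P, a / 2 < fderiv ℝ G p (0, 1)
        + fderiv ℝ G p (1, 0) * (σ * Real.sqrt (G p)) := by
      apply hH.eventually_const_lt
      simp only [h0, Real.sqrt_zero, ← hadef]
      linarith
    filter_upwards [hN, e1, e2] with p h1 h2 h3
    exact ⟨h1, h2.differentiableAt (by simp), h3⟩
  have hcur : ContinuousWithinAt (fun ψ => (Φ ψ, ψ)) (Icc P.2 (P.2 + ε)) P.2 :=
    (hc P.2 ⟨le_rfl, by linarith⟩).prodMk continuousWithinAt_id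
  have hev := hcur.eventually (p := fun p => p ∈ N ∧ DifferentiableAt ℝ G p ∧
      a / 2 < fderiv ℝ G p (0, 1) + fderiv ℝ G p (1, 0) * (σ * Real.sqrt (G p)))
      (by simpa [hP] using hgood)
  rw [eventually_nhdsWithin_iff] at hev
  obtain ⟨d, hd0, hball⟩ := Metric.eventually_nhds_iff.1 hev
  refine ⟨min ε (d / 2), by positivity, min_le_left _ _, ?_⟩
  set η := min ε (d / 2) with hη
  have hηε : η ≤ ε := min_le_left _ _
  have hηd : η ≤ d / 2 := min_le_right _ _
  have hη0 : 0 < η := by positivity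
  have hB : ∀ ψ ∈ Icc P.2 (P.2 + η), (Φ ψ, ψ) ∈ N ∧ DifferentiableAt ℝ G (Φ ψ, ψ) ∧
      a / 2 < fderiv ℝ G (Φ ψ, ψ) (0, 1)
        + fderiv ℝ G (Φ ψ, ψ) (1, 0) * (σ * Real.sqrt (G (Φ ψ, ψ))) := by
    intro ψ hψ
    apply hball
    · rw [Real.dist_eq, abs_of_nonneg (by linarith [hψ.1])]
      linarith [hψ.2]
    · exact ⟨hψ.1, by linarith [hψ.2]⟩
  have hder : ∀ ψ ∈ Ioo P.2 (P.2 + η),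
      HasDerivAt (fun ψ => G (Φ ψ, ψ) - a / 2 * (ψ - P.2))
      (fderiv ℝ G (Φ ψ, ψ) (0, 1)
        + fderiv ℝ G (Φ ψ, ψ) (1, 0) * (σ * Real.sqrt (G (Φ ψ, ψ))) - a / 2) ψ := by
    intro ψ hψ
    have h1 := (hd ψ ⟨hψ.1, by linarith [hψ.2]⟩).prodMk (hasDerivAt_id ψ)
    have h2 := HasFDerivAt.comp_hasDerivAt (f := fun ψ => (Φ ψ, ψ)) ψ
      (hB ψ ⟨hψ.1.le, hψ.2.le⟩).2.1.hasFDerivAt h1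
    have h3 := h2.sub (((hasDerivAt_id ψ).sub_const P.2).const_mul (a / 2))
    refine h3.congr_deriv ?_
    have hdec : (σ * Real.sqrt (G (Φ ψ, ψ)), (1 : ℝ))
        = (σ * Real.sqrt (G (Φ ψ, ψ))) • ((1 : ℝ), (0 : ℝ)) + ((0 : ℝ), (1 : ℝ)) := by simp
    rw [hdec, map_add, map_smul, smul_eq_mul]
    ring
  have hmono : MonotoneOn (fun ψ => G (Φ ψ, ψ) - a / 2 * (ψ - P.2)) (Icc P.2 (P.2 + η)) := by
    apply monotoneOn_of_deriv_nonneg (convex_Icc _ _)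
    · intro ψ hψ
      have h1 : ContinuousWithinAt (fun ψ => (Φ ψ, ψ)) (Icc P.2 (P.2 + η)) ψ :=
        ((hc ψ ⟨hψ.1, by linarith [hψ.2]⟩).mono
          (Icc_subset_Icc le_rfl (by linarith))).prodMk continuousWithinAt_id
      have h2 := (hB ψ hψ).2.1.continuousAt.comp_continuousWithinAt
        (f := fun ψ => (Φ ψ, ψ)) h1
      exact h2.sub (by fun_prop)
    · rw [interior_Icc]
      exact fun ψ hψ => (hder ψ hψ).differentiableAt.differentiableWithinAt
    · rw [interior_Icc]
      intro ψ hψ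
      rw [(hder ψ hψ).deriv]
      linarith [(hB ψ ⟨hψ.1.le, hψ.2.le⟩).2.2]
  intro ψ hψ
  refine ⟨(hB ψ hψ).1, ?_⟩
  have := hmono ⟨le_rfl, by linarith⟩ hψ hψ.1
  simp only [hP, h0] at this
  simpa [h0] using this

open Topology in
theorem core_unique (G : ℝ × ℝ → ℝ) (P : ℝ × ℝ) (σ : ℝ) (hG : ContDiffAt ℝ 2 G P)
    (h0 : G P = 0) (ha : 0 < fderiv ℝ G P (0, 1)) (ε : ℝ) (hε : 0 < ε) (Φ1 Φ2 : ℝ → ℝ)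
    (hc1 : ContinuousOn Φ1 (Icc P.2 (P.2 + ε))) (hP1 : Φ1 P.2 = P.1)
    (hd1 : ∀ ψ ∈ Ioo P.2 (P.2 + ε), HasDerivAt Φ1 (σ * Real.sqrt (G (Φ1 ψ, ψ))) ψ)
    (hc2 : ContinuousOn Φ2 (Icc P.2 (P.2 + ε))) (hP2 : Φ2 P.2 = P.1)
    (hd2 : ∀ ψ ∈ Ioo P.2 (P.2 + ε), HasDerivAt Φ2 (σ * Real.sqrt (G (Φ2 ψ, ψ))) ψ) :
    ∃ η > 0, ∀ ψ ∈ Icc P.2 (P.2 + η), Φ1 ψ = Φ2 ψ := by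
  obtain ⟨L, N, hN, hL⟩ := (hG.of_le (m := 1) (by norm_num)).exists_lipschitzOnWith
  obtain ⟨η1, hη1, hη1ε, hl1⟩ := core_lower G P σ hG h0 ha ε hε Φ1 hc1 hP1 hd1 N hN
  obtain ⟨η2, hη2, hη2ε, hl2⟩ := core_lower G P σ hG h0 ha ε hε Φ2 hc2 hP2 hd2 N hN
  set a := fderiv ℝ G P (0, 1) with hadef
  set η := min η1 η2 with hη
  have hηη1 : η ≤ η1 := min_le_left _ _
  have hηη2 : η ≤ η2 := min_le_right _ _
  have hη0 : 0 < η := by positivity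
  refine ⟨η, hη0, ?_⟩
  set K : ℝ := |σ| * L / Real.sqrt (a / 2) with hK
  have hsa : 0 < Real.sqrt (a / 2) := Real.sqrt_pos.2 (by positivity)
  set W : ℝ → ℝ := fun ψ => (Φ1 ψ - Φ2 ψ) ^ 2 * Real.exp (-(4 * K * Real.sqrt (ψ - P.2))) with hW
  have hder : ∀ ψ ∈ Ioo P.2 (P.2 + η), ∃ D ≤ 0, HasDerivAt W D ψ := by
    intro ψ hψ
    have hτ : 0 < ψ - P.2 := by linarith [hψ.1]
    have hψI : ψ ∈ Ioo P.2 (P.2 + ε) := ⟨hψ.1, by linarith [hψ.2]⟩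
    have hw := (hd1 ψ hψI).sub (hd2 ψ hψI)
    have hs : HasDerivAt (fun ψ => Real.sqrt (ψ - P.2)) (1 / (2 * Real.sqrt (ψ - P.2))) ψ :=
      ((hasDerivAt_id ψ).sub_const P.2).sqrt hτ.ne'
    have hD := (hw.pow 2).mul ((hs.const_mul (4 * K)).neg.exp)
    obtain ⟨n1, l1⟩ := hl1 ψ ⟨hψ.1.le, by linarith [hψ.2]⟩
    obtain ⟨n2, l2⟩ := hl2 ψ ⟨hψ.1.le, by linarith [hψ.2]⟩
    have hlip := hL.dist_le_mul _ n1 _ n2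
    rw [Prod.dist_eq, dist_self, max_eq_left dist_nonneg, Real.dist_eq, Real.dist_eq] at hlip
    set u1 := G (Φ1 ψ, ψ)
    set u2 := G (Φ2 ψ, ψ)
    set w := Φ1 ψ - Φ2 ψ with hwdef
    set r := Real.sqrt (ψ - P.2) with hr
    have hrpos : 0 < r := Real.sqrt_pos.2 hτ
    have hlow1 : Real.sqrt (a / 2) * r ≤ Real.sqrt u1 := by
      rw [hr, ← Real.sqrt_mul (by positivity)]
      exact Real.sqrt_le_sqrt l1
    have hu1 : 0 ≤ u1 := le_trans (by positivity) l1
    have hu2 : 0 ≤ u2 := le_trans (by positivity) l2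
    have hdiff : |Real.sqrt u1 - Real.sqrt u2| * (Real.sqrt (a / 2) * r) ≤ L * |w| := by
      calc |Real.sqrt u1 - Real.sqrt u2| * (Real.sqrt (a / 2) * r)
          ≤ |Real.sqrt u1 - Real.sqrt u2| * (Real.sqrt u1 + Real.sqrt u2) := by
            gcongr
            linarith [Real.sqrt_nonneg u2]
        _ = |u1 - u2| := by
            rw [← abs_of_nonneg (add_nonneg (Real.sqrt_nonneg u1) (Real.sqrt_nonneg u2)),
              ← abs_mul]
            congr 1
            have e1 := Real.mul_self_sqrt hu1
            have e2 := Real.mul_self_sqrt hu2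
            linear_combination e1 - e2
        _ ≤ L * |w| := hlip
    have hkey : w * (σ * Real.sqrt u1 - σ * Real.sqrt u2) ≤ w ^ 2 * (K / r) := by
      calc w * (σ * Real.sqrt u1 - σ * Real.sqrt u2)
          ≤ |w * (σ * Real.sqrt u1 - σ * Real.sqrt u2)| := le_abs_self _
        _ = |w| * |σ| * |Real.sqrt u1 - Real.sqrt u2| := by
            rw [← mul_sub, abs_mul, abs_mul]; ring
        _ ≤ |w| * |σ| * (L * |w| / (Real.sqrt (a / 2) * r)) := by
            gcongr
            rw [le_div_iff₀ (by positivity)]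
            exact hdiff
        _ = w ^ 2 * (K / r) := by
            rw [hK, ← sq_abs w]
            field_simp
    have hexp := Real.exp_pos (-(4 * K * r))
    refine ⟨2 * ((w * (σ * Real.sqrt u1 - σ * Real.sqrt u2) - w ^ 2 * (K / r))
        * Real.exp (-(4 * K * r))), ?_, ?_⟩
    · have := mul_nonpos_of_nonpos_of_nonneg (sub_nonpos.2 hkey) hexp.le
      linarith
    · refine hD.congr_deriv ?_
      simp only [Pi.sub_apply, Pi.pow_apply, Pi.neg_apply, ← hwdef, ← hr]
      push_cast
      field_simp
      ring
  have hanti : AntitoneOn W (Icc P.2 (P.2 + η)) := by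
    apply antitoneOn_of_deriv_nonpos (convex_Icc _ _)
    · have i1 : Icc P.2 (P.2 + η) ⊆ Icc P.2 (P.2 + ε) := Icc_subset_Icc le_rfl (by linarith)
      have := ((hc1.mono i1).sub (hc2.mono i1)).pow 2
      exact this.mul (Continuous.continuousOn (by fun_prop))
    · rw [interior_Icc]
      intro ψ hψ
      obtain ⟨D, _, hD⟩ := hder ψ hψ
      exact hD.differentiableAt.differentiableWithinAt
    · rw [interior_Icc]
      intro ψ hψ
      obtain ⟨D, hD0, hD⟩ := hder ψ hψ
      rw [hD.deriv]; exact hD0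
  intro ψ hψ
  have h1 := hanti ⟨le_rfl, by linarith⟩ hψ hψ.1
  have h2 : W P.2 = 0 := by simp [hW, hP1, hP2]
  rw [h2] at h1
  have h3 : 0 < Real.exp (-(4 * K * Real.sqrt (ψ - P.2))) := Real.exp_pos _
  have h4 : (Φ1 ψ - Φ2 ψ) ^ 2 ≤ 0 := by
    by_contra h
    push Not at h
    have : 0 < W ψ := mul_pos h h3
    linarith
  have h5 : Φ1 ψ - Φ2 ψ = 0 := by
    have := sq_nonneg (Φ1 ψ - Φ2 ψ)
    exact pow_eq_zero_iff (two_ne_zero) |>.1 (le_antisymm h4 this)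
  linarith

theorem m_pos {γ : ℝ} (hγ : 1 < γ) {s : ℝ} (hs : s ∈ Ioo 0 (qmaxF γ)) :
    0 < 1 - (γ - 1) / 2 * s ^ 2 := by
  have h1 : s ^ 2 < 2 / (γ - 1) := (Real.lt_sqrt hs.1.le).1 hs.2
  have h2 : 0 < γ - 1 := by linarith
  rw [lt_div_iff₀ h2] at h1
  linarith

theorem cstar_pos {γ : ℝ} (hγ : 1 < γ) : 0 < cstar γ :=
  Real.sqrt_pos.2 (by have : 0 < γ + 1 := by linarith
                      positivity)

theorem cstar_sq {γ : ℝ} (hγ : 1 < γ) : cstar γ ^ 2 = 2 / (γ + 1) :=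
  Real.sq_sqrt (by have : 0 < γ + 1 := by linarith
                   positivity)

theorem cstar_mem {γ : ℝ} (hγ : 1 < γ) : cstar γ ∈ Ioo 0 (qmaxF γ) := by
  refine ⟨cstar_pos hγ, ?_⟩
  have h2 : 0 < γ - 1 := by linarith
  have h1 : 0 < γ + 1 := by linarith
  apply Real.sqrt_lt_sqrt (by positivity)
  gcongr
  linarith

theorem rho_pos {γ : ℝ} (hγ : 1 < γ) {s : ℝ} (hs : s ∈ Ioo 0 (qmaxF γ)) :
    0 < rhoF γ (s ^ 2) := Real.rpow_pos_of_pos (m_pos hγ hs) _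

theorem rho_contDiffAt {γ : ℝ} (hγ : 1 < γ) {s : ℝ} (hs : s ∈ Ioo 0 (qmaxF γ)) :
    ContDiffAt ℝ 2 (fun s => rhoF γ (s ^ 2)) s := by
  unfold rhoF
  exact ContDiffAt.rpow_const_of_ne (by fun_prop) (m_pos hγ hs).ne'

theorem rho_deriv {γ : ℝ} (hγ : 1 < γ) {s : ℝ} (hs : s ∈ Ioo 0 (qmaxF γ)) :
    deriv (rhoF γ) (s ^ 2) = -(1 / 2) * rhoF γ (s ^ 2) / (1 - (γ - 1) / 2 * s ^ 2) := by
  have hm := m_pos hγ hs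
  have h2 : 0 < γ - 1 := by linarith
  have h1 : HasDerivAt (fun t : ℝ => 1 - (γ - 1) / 2 * t) (-((γ - 1) / 2)) (s ^ 2) := by
    simpa using ((hasDerivAt_id (s ^ 2)).const_mul ((γ - 1) / 2)).const_sub 1
  have h3 := h1.rpow_const (p := 1 / (γ - 1)) (Or.inl hm.ne')
  have h4 : deriv (rhoF γ) (s ^ 2) = _ := h3.deriv
  rw [h4, Real.rpow_sub_one hm.ne']
  unfold rhoF
  field_simp

theorem ftc_aux {f : ℝ → ℝ} {a b c x : ℝ} (hf : ContinuousOn f (Ioo a b)) (hc : c ∈ Ioo a b)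
    (hx : x ∈ Ioo a b) : deriv (fun u => ∫ s in c..u, f s) x = f x := by
  apply HasDerivAt.deriv
  apply intervalIntegral.integral_hasDerivAt_right
  · apply ContinuousOn.intervalIntegrable
    exact hf.mono (ordConnected_Ioo.uIcc_subset hc hx)
  · exact hf.stronglyMeasurableAtFilter isOpen_Ioo x hx
  · exact hf.continuousAt (isOpen_Ioo.mem_nhds hx)

theorem ratio_eq {γ : ℝ} (hγ : 1 < γ) {s : ℝ} (hs : s ∈ Ioo 0 (qmaxF γ)) :
    -(deriv (Afun γ) s) / deriv (Bfun γ) s =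
      ((γ + 1) / 2 * s ^ 2 - 1) * ((1 - (γ - 1) / 2 * s ^ 2) * rhoF γ (s ^ 2) ^ 2)⁻¹ := by
  have hrc : ContinuousOn (fun s => rhoF γ (s ^ 2)) (Ioo 0 (qmaxF γ)) := fun s hs =>
    (rho_contDiffAt hγ hs).continuousAt.continuousWithinAt
  have hA : ContinuousOn (fun s => (rhoF γ (s ^ 2) + 2 * s ^ 2 * deriv (rhoF γ) (s ^ 2))
      / (s * (rhoF γ (s ^ 2)) ^ 2)) (Ioo 0 (qmaxF γ)) := by
    refine ContinuousOn.div (hrc.add (ContinuousOn.mul (by fun_prop) ?_))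
      (continuousOn_id.mul (hrc.pow 2)) ?_
    · refine ContinuousOn.congr (f := fun s =>
        -(1 / 2) * rhoF γ (s ^ 2) / (1 - (γ - 1) / 2 * s ^ 2)) ?_ (fun s hs => rho_deriv hγ hs)
      exact (continuousOn_const.mul hrc).div (by fun_prop) (fun s hs => (m_pos hγ hs).ne')
    · intro s hs
      have := rho_pos hγ hs
      have := hs.1
      positivity
  have hB : ContinuousOn (fun s => rhoF γ (s ^ 2) / s) (Ioo 0 (qmaxF γ)) :=
    hrc.div continuousOn_id (fun s hs => hs.1.ne')
  have eA : deriv (Afun γ) s = _ := ftc_aux hA (cstar_mem hγ) hs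
  have eB : deriv (Bfun γ) s = _ := ftc_aux hB (cstar_mem hγ) hs
  rw [eA, eB, rho_deriv hγ hs]
  have h1 := rho_pos hγ hs
  have h2 := m_pos hγ hs
  have h3 := hs.1
  set R := rhoF γ (s ^ 2)
  have h4 : (γ + 1) / 2 * s ^ 2 - 1 = s ^ 2 - (1 - (γ - 1) / 2 * s ^ 2) := by ring
  rw [h4]
  generalize 1 - (γ - 1) / 2 * s ^ 2 = M at h2 ⊢
  field_simp
  ring

theorem IsChar.mono {γ : ℝ} {U : Set (ℝ × ℝ)} {q : ℝ × ℝ → ℝ} {P : ℝ × ℝ} {sgn ε ε' : ℝ}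
    {Φ : ℝ → ℝ} (h : IsChar γ U q P sgn ε Φ) (hε : ε' ≤ ε) : IsChar γ U q P sgn ε' Φ := by
  obtain ⟨h1, h2, h3, h4⟩ := h
  have hs : Icc P.2 (P.2 + ε') ⊆ Icc P.2 (P.2 + ε) := Icc_subset_Icc le_rfl (by linarith)
  exact ⟨h1.mono hs, h2, fun ψ hψ => h3 ψ ⟨hψ.1, by linarith [hψ.2]⟩,
    fun ψ hψ => (h4 ψ ⟨hψ.1, by linarith [hψ.2]⟩).mono hs⟩

/-- existence and uniqueness of the positive and negative
characteristics issuing from a nonexceptional sonic point (Lemma `nov-lemma1`). -/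
theorem stmt_15 (γ : ℝ) (hγ : 1 < γ)
    (U : Set (ℝ × ℝ)) (hU : IsOpen U)
    (P : ℝ × ℝ) (hP : P ∈ U)
    (q : ℝ × ℝ → ℝ) (hq : ContDiffOn ℝ 2 q U)
    (hson : q P = cstar γ) (hnex : 0 < pdy q P) :
    ∃ ε > 0,
      ((∃ Φp : ℝ → ℝ, IsChar γ U q P 1 ε Φp) ∧
       (∃ Φm : ℝ → ℝ, IsChar γ U q P (-1) ε Φm)) ∧
      (∀ sgn : ℝ, (sgn = 1 ∨ sgn = -1) →
        ∀ ε1 ε2 : ℝ, 0 < ε1 → 0 < ε2 → ∀ Φ1 Φ2 : ℝ → ℝ,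
          IsChar γ U q P sgn ε1 Φ1 → IsChar γ U q P sgn ε2 Φ2 →
          ∃ ε' > 0, ∀ ψ ∈ Icc P.2 (P.2 + ε'), Φ1 ψ = Φ2 ψ) := by
  classical
  set r : ℝ → ℝ := fun s => ((1 - (γ - 1) / 2 * s ^ 2) * rhoF γ (s ^ 2) ^ 2)⁻¹ with hr
  set h : ℝ → ℝ := fun s => ((γ + 1) / 2 * s ^ 2 - 1) * r s with hh
  set G : ℝ × ℝ → ℝ := fun p => h (q p) with hGdef
  have hcm := cstar_mem hγ
  have hγ1 : 0 < γ + 1 := by linarith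
  have hrpos : ∀ s ∈ Ioo 0 (qmaxF γ), 0 < r s := fun s hs => by
    have h1 := rho_pos hγ hs
    have h2 := m_pos hγ hs
    simp only [hr]; positivity
  have hrd : ContDiffAt ℝ 2 r (cstar γ) := by
    apply ContDiffAt.inv
    · exact ContDiffAt.mul (by fun_prop) ((rho_contDiffAt hγ hcm).pow 2)
    · have h1 := rho_pos hγ hcm
      have h2 := m_pos hγ hcm
      positivity
  have hhd : ContDiffAt ℝ 2 h (cstar γ) := ContDiffAt.mul (by fun_prop) hrd
  have hk0 : (γ + 1) / 2 * cstar γ ^ 2 - 1 = 0 := by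
    rw [cstar_sq hγ]; field_simp; ring
  have hh0 : h (cstar γ) = 0 := by simp only [hh, hk0, zero_mul]
  have hh' : HasDerivAt h ((γ + 1) * cstar γ * r (cstar γ)) (cstar γ) := by
    have h1 : HasDerivAt (fun s : ℝ => (γ + 1) / 2 * s ^ 2 - 1) ((γ + 1) * cstar γ)
        (cstar γ) := by
      refine (((hasDerivAt_pow 2 (cstar γ)).const_mul ((γ + 1) / 2)).sub_const 1).congr_deriv ?_
      push_cast
      ring
    have h2 := h1.mul (hrd.differentiableAt (by simp)).hasDerivAt
    refine h2.congr_deriv ?_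
    rw [hk0]; ring
  have hqP : ContDiffAt ℝ 2 q P := hq.contDiffAt (hU.mem_nhds hP)
  have hG : ContDiffAt ℝ 2 G P := ContDiffAt.comp (g := h) P (by rw [hson]; exact hhd) hqP
  have hG0 : G P = 0 := by simp only [hGdef, hson, hh0]
  have hqd : DifferentiableAt ℝ q P := hqP.differentiableAt (by simp)
  have hpdy : pdy q P = fderiv ℝ q P (0, 1) := by
    have h1 : HasDerivAt (fun y : ℝ => (P.1, y)) ((0 : ℝ), (1 : ℝ)) P.2 :=
      (hasDerivAt_const P.2 P.1).prodMk (hasDerivAt_id P.2)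
    exact (HasFDerivAt.comp_hasDerivAt (f := fun y : ℝ => (P.1, y)) P.2
      hqd.hasFDerivAt h1).deriv
  have hGf : fderiv ℝ G P (0, 1) = (γ + 1) * cstar γ * r (cstar γ) * pdy q P := by
    have h1 : HasDerivAt h ((γ + 1) * cstar γ * r (cstar γ)) (q P) := by rw [hson]; exact hh'
    have h2 : HasFDerivAt G _ P := h1.comp_hasFDerivAt P hqd.hasFDerivAt
    rw [h2.fderiv, hpdy]
    simp
  have ha : 0 < fderiv ℝ G P (0, 1) := by
    rw [hGf]
    have := hrpos _ hcm
    have := cstar_pos hγ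
    positivity
  -- the good neighbourhood
  set N : Set (ℝ × ℝ) := {p | p ∈ U ∧ q p ∈ Ioo 0 (qmaxF γ)} with hN
  have hNn : N ∈ nhds P := by
    have h1 : ∀ᶠ p in nhds P, q p ∈ Ioo 0 (qmaxF γ) :=
      hqP.continuousAt.eventually (isOpen_Ioo.mem_nhds (by rw [hson]; exact hcm))
    filter_upwards [hU.mem_nhds hP, h1] with p h2 h3
    exact ⟨h2, h3⟩
  have hNG : ∀ p ∈ N, -(deriv (Afun γ) (q p)) / deriv (Bfun γ) (q p) = G p :=
    fun p hp => ratio_eq hγ hp.2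
  have hNpos : ∀ p ∈ N, 0 < G p → cstar γ < q p := by
    intro p hp h0
    have h1 : 0 < (γ + 1) / 2 * q p ^ 2 - 1 :=
      pos_of_mul_pos_left h0 (hrpos _ hp.2).le
    have h2 : cstar γ ^ 2 < q p ^ 2 := by
      by_contra hcon
      push Not at hcon
      have := mul_le_mul_of_nonneg_left hcon (by positivity : 0 ≤ (γ + 1) / 2)
      linarith
    exact lt_of_pow_lt_pow_left₀ 2 hp.2.1.le h2
  have hex : ∀ σ : ℝ, ∃ ε > 0, ∃ Φ, IsChar γ U q P σ ε Φ := by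
    intro σ
    obtain ⟨ε, hε, Φ, hc, h0, hd⟩ := core_exist G P σ hG hG0 ha N hNn
    refine ⟨ε, hε, Φ, hc, h0, fun ψ hψ => ?_, fun ψ hψ => ?_⟩
    · obtain ⟨h1, h2, _⟩ := hd ψ hψ
      exact ⟨h1.1, hNpos _ h1 h2⟩
    · obtain ⟨h1, _, h3⟩ := hd ψ hψ
      rw [hNG _ h1]
      exact h3.hasDerivWithinAt
  obtain ⟨εp, hεp, Φp, hΦp⟩ := hex 1
  obtain ⟨εm, hεm, Φm, hΦm⟩ := hex (-1)
  refine ⟨min εp εm, lt_min hεp hεm, ⟨⟨Φp, hΦp.mono (min_le_left _ _)⟩,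
    ⟨Φm, hΦm.mono (min_le_right _ _)⟩⟩, ?_⟩
  have hloc : ∀ (σ ε : ℝ), 0 < ε → ∀ Φ : ℝ → ℝ, IsChar γ U q P σ ε Φ →
      ∃ η > 0, ∀ η' ≤ η, ContinuousOn Φ (Icc P.2 (P.2 + η')) ∧
        ∀ ψ ∈ Ioo P.2 (P.2 + η'), HasDerivAt Φ (σ * Real.sqrt (G (Φ ψ, ψ))) ψ := by
    rintro σ ε hε Φ ⟨h1, h2, h3, h4⟩
    have hcur : ContinuousWithinAt (fun ψ => (Φ ψ, ψ)) (Icc P.2 (P.2 + ε)) P.2 :=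
      (h1 P.2 ⟨le_rfl, by linarith⟩).prodMk continuousWithinAt_id
    have hev := hcur.eventually (p := fun p => p ∈ N) (by simpa [h2] using hNn)
    rw [eventually_nhdsWithin_iff] at hev
    obtain ⟨d, hd0, hball⟩ := Metric.eventually_nhds_iff.1 hev
    refine ⟨min ε d, lt_min hε hd0, fun η' hη' => ⟨?_, ?_⟩⟩
    · exact h1.mono (Icc_subset_Icc le_rfl (by linarith [min_le_left ε d]))
    · intro ψ hψ
      have hψε : ψ < P.2 + ε := by linarith [min_le_left ε d, hψ.2]
      have hpN : (Φ ψ, ψ) ∈ N := by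
        apply hball
        · rw [Real.dist_eq, abs_of_nonneg (by linarith [hψ.1])]
          linarith [hψ.2, min_le_right ε d]
        · exact ⟨hψ.1.le, hψε.le⟩
      have := h4 ψ ⟨hψ.1, hψε.le⟩
      rw [hNG _ hpN] at this
      exact this.hasDerivAt (Icc_mem_nhds hψ.1 hψε)
  intro σ _ ε1 ε2 hε1 hε2 Φ1 Φ2 hΦ1 hΦ2
  obtain ⟨η1, hη1, H1⟩ := hloc σ ε1 hε1 Φ1 hΦ1
  obtain ⟨η2, hη2, H2⟩ := hloc σ ε2 hε2 Φ2 hΦ2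
  obtain ⟨c1, d1⟩ := H1 (min η1 η2) (min_le_left _ _)
  obtain ⟨c2, d2⟩ := H2 (min η1 η2) (min_le_right _ _)
  exact core_unique G P σ hG hG0 ha (min η1 η2) (lt_min hη1 hη2) Φ1 Φ2
    c1 hΦ1.2.1 d1 c2 hΦ2.2.1 d2
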